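/- For every integer d ≥ 1, every α ∈ (0,2) and every p ∈ (α/2, α), there is a positive constant C = C(d, α, p) such that for every x ∈ ℝ^d with x_1 > 0 the principal value limit defining Δ^{α/2} w_p(x) exists and Δ^{α/2} w_p(x) = C · x_1^{p−α}. -/

import Mathlib

open MeasureTheory Filter Set

/-- The constant 𝒜(d, -α) = α 2^{α-1} π^{-d/2} Γ((d+α)/2) Γ(1-α/2)^{-1}. -/
noncomputable def fracConst (d : ℕ) (α : ℝ) : ℝ :=
  α * 2 ^ (α - 1) * Real.pi ^ (-(d : ℝ) / 2) *
    Real.Gamma (((d : ℝ) + α) / 2) / Real.Gamma (1 - α / 2)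

/-- The truncated-at-ε integral ∫_{|y-x|>ε} (u(y)-u(x)) |x-y|^{-d-α} dy whose limit
as ε ↓ 0 gives the principal value integral defining the fractional Laplacian
(up to the constant `fracConst`). -/
noncomputable def pvInt (d : ℕ) (α : ℝ) (u : EuclideanSpace ℝ (Fin d) → ℝ)
    (x : EuclideanSpace ℝ (Fin d)) (ε : ℝ) : ℝ :=
  ∫ y in {y : EuclideanSpace ℝ (Fin d) | ε < dist y x},
    (u y - u x) / dist x y ^ ((d : ℝ) + α)

/-- The symmetric second difference at `1` of the function `t ↦ (t⁺) ^ p`. -/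
noncomputable def powSecondDiff (p s : ℝ) : ℝ :=
  (max (1 + s) 0) ^ p + (max (1 - s) 0) ^ p - 2

lemma powSecondDiff_neg (p s : ℝ) : powSecondDiff p (-s) = powSecondDiff p s := by
  unfold powSecondDiff
  rw [sub_neg_eq_add, ← sub_eq_add_neg]
  ring

lemma powSecondDiff_abs (p s : ℝ) : powSecondDiff p |s| = powSecondDiff p s := by
  rcases abs_choice s with h | h <;> rw [h]
  exact powSecondDiff_neg p s

lemma powSecondDiff_zero (p : ℝ) : powSecondDiff p 0 = 0 := by
  norm_num [powSecondDiff]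

lemma continuous_powSecondDiff {p : ℝ} (hp : 0 < p) : Continuous (powSecondDiff p) := by
  unfold powSecondDiff
  exact (((by fun_prop : Continuous fun s : ℝ => max (1 + s) 0).rpow_const fun _ => Or.inr hp.le).add
    ((by fun_prop : Continuous fun s : ℝ => max (1 - s) 0).rpow_const fun _ => Or.inr hp.le)).sub
    continuous_const

lemma max_one_add_rpow_le {p : ℝ} (hp : 0 < p) (hp2 : p < 2) (s : ℝ) :
    (max (1 + s) 0) ^ p ≤ 1 + p / 2 * (2 * s + s ^ 2) := by
  have h1 : (max (1 + s) 0) ^ p ≤ |1 + s| ^ p :=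
    Real.rpow_le_rpow (le_max_right _ _) (max_le (le_abs_self _) (abs_nonneg _)) hp.le
  have h2 : |1 + s| ^ p = (1 + (2 * s + s ^ 2)) ^ (p / 2) := by
    rw [show 1 + (2 * s + s ^ 2) = |1 + s| ^ (2 : ℝ) by
      rw [Real.rpow_two, sq_abs]; ring, ← Real.rpow_mul (abs_nonneg _)]
    congr 1; ring
  rw [h2] at h1
  exact h1.trans (rpow_one_add_le_one_add_mul_self (by nlinarith [sq_nonneg (s + 1)])
    (by positivity) (by linarith))

lemma abs_powSecondDiff_le_sq {p : ℝ} (hp : 0 < p) (hp2 : p < 2) {s : ℝ} (hs : 0 ≤ s)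
    (hs1 : s ≤ 1) : |powSecondDiff p s| ≤ 2 * s ^ 2 := by
  rw [abs_le]
  constructor
  · rw [powSecondDiff, max_eq_left (by linarith), max_eq_left (by linarith)]
    have hu : 0 ≤ (1 + s) ^ (p / 2) := Real.rpow_nonneg (by linarith) _
    have hv : 0 ≤ (1 - s) ^ (p / 2) := Real.rpow_nonneg (by linarith) _
    have e1 : (1 + s) ^ p = ((1 + s) ^ (p / 2)) ^ 2 := by
      rw [← Real.rpow_natCast, ← Real.rpow_mul (by linarith)]; norm_num
    have e2 : (1 - s) ^ p = ((1 - s) ^ (p / 2)) ^ 2 := by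
      rw [← Real.rpow_natCast, ← Real.rpow_mul (by linarith)]; norm_num
    have e3 : (1 + s) ^ (p / 2) * (1 - s) ^ (p / 2) = (1 - s ^ 2) ^ (p / 2) := by
      rw [← Real.mul_rpow (by linarith) (by linarith)]; ring_nf
    have h4 : 1 - s ^ 2 ≤ (1 - s ^ 2) ^ (p / 2) := by
      apply Real.self_le_rpow_of_le_one <;> nlinarith
    rw [e1, e2]
    nlinarith [sq_nonneg ((1 + s) ^ (p / 2) - (1 - s) ^ (p / 2))]
  · have h1 := max_one_add_rpow_le hp hp2 s
    have h2 := max_one_add_rpow_le hp hp2 (-s)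
    rw [← sub_eq_add_neg] at h2
    rw [powSecondDiff]
    nlinarith [sq_nonneg s]

lemma abs_powSecondDiff_le_rpow {p : ℝ} (hp : 0 < p) (hp2 : p < 2) {s : ℝ} (hs1 : 1 ≤ s) :
    |powSecondDiff p s| ≤ 4 * s ^ p := by
  have h1 : 1 ≤ s ^ p := Real.one_le_rpow hs1 hp.le
  rw [powSecondDiff, max_eq_left (by linarith), max_eq_right (by linarith),
    Real.zero_rpow hp.ne', abs_le]
  have h2 : (1 + s) ^ p ≤ 4 * s ^ p := by
    calc (1 + s) ^ p ≤ (2 * s) ^ p := Real.rpow_le_rpow (by linarith) (by linarith) hp.le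
      _ = 2 ^ p * s ^ p := Real.mul_rpow (by norm_num) (by linarith)
      _ ≤ 2 ^ (2 : ℝ) * s ^ p := by
        gcongr
        norm_num
      _ = _ := by norm_num
  have h3 : 0 ≤ (1 + s) ^ p := Real.rpow_nonneg (by linarith) _
  constructor <;> linarith

lemma abs_powSecondDiff_le {p : ℝ} (hp : 0 < p) (hp2 : p < 2) (s : ℝ) :
    |powSecondDiff p s| ≤ 4 * min (|s| ^ 2) (|s| ^ p) := by
  rw [← powSecondDiff_abs]
  have h0 := abs_nonneg s
  rw [← Real.rpow_two]
  rcases le_total |s| 1 with h | h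
  · rw [min_eq_left (Real.rpow_le_rpow_of_exponent_ge_of_imp h0 h hp2.le (by simp)), Real.rpow_two]
    nlinarith [abs_powSecondDiff_le_sq hp hp2 h0 h, sq_nonneg |s|]
  · rw [min_eq_right (Real.rpow_le_rpow_of_exponent_le h hp2.le)]
    exact abs_powSecondDiff_le_rpow hp hp2 h

lemma integrableOn_min_sq_rpow_mul_rpow {α p : ℝ} (hα2 : α < 2) (hpα : p < α) :
    IntegrableOn (fun s : ℝ => min (s ^ 2) (s ^ p) * s ^ (-1 - α)) (Ioi 0) := by
  have hm : Measurable fun s : ℝ => min (s ^ 2) (s ^ p) * s ^ (-1 - α) := by fun_prop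
  rw [← Ioo_union_Ici_eq_Ioi (zero_lt_one' ℝ), integrableOn_union]
  constructor
  · have h := (intervalIntegral.integrableOn_Ioo_rpow_iff (s := 1 - α) zero_lt_one).2 (by linarith)
    refine h.mono' hm.aestronglyMeasurable ?_
    filter_upwards [ae_restrict_mem measurableSet_Ioo] with s hs
    have hs0 : 0 < s := hs.1
    rw [Real.norm_of_nonneg (by positivity)]
    calc _ ≤ s ^ 2 * s ^ (-1 - α) := by gcongr; exact min_le_left _ _
      _ = _ := by rw [← Real.rpow_two, ← Real.rpow_add hs0]; ring_nf
  · rw [integrableOn_Ici_iff_integrableOn_Ioi]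
    have h := integrableOn_Ioi_rpow_of_lt (a := p - 1 - α) (by linarith) zero_lt_one
    refine h.mono' hm.aestronglyMeasurable ?_
    filter_upwards [ae_restrict_mem measurableSet_Ioi] with s hs
    have hs0 : 0 < s := zero_lt_one.trans hs
    rw [Real.norm_of_nonneg (by positivity)]
    calc _ ≤ s ^ p * s ^ (-1 - α) := by gcongr; exact min_le_right _ _
      _ = _ := by rw [← Real.rpow_add hs0]; ring_nf

lemma integrableOn_powSecondDiff_mul_rpow {α p : ℝ} (hα2 : α < 2) (hp : 0 < p) (hpα : p < α) :
    IntegrableOn (fun s : ℝ => powSecondDiff p s * s ^ (-1 - α)) (Ioi 0) := by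
  have hm : Measurable fun s : ℝ => powSecondDiff p s * s ^ (-1 - α) :=
    (continuous_powSecondDiff hp).measurable.mul (by fun_prop)
  refine ((integrableOn_min_sq_rpow_mul_rpow hα2 hpα).const_mul 4).mono'
    hm.aestronglyMeasurable ?_
  filter_upwards [ae_restrict_mem measurableSet_Ioi] with s hs
  have hs0 : 0 < s := hs
  have h := abs_powSecondDiff_le hp (hpα.trans hα2) s
  rw [abs_of_pos hs0] at h
  rw [norm_mul, Real.norm_eq_abs, Real.norm_of_nonneg (by positivity), ← mul_assoc]
  gcongr

/-- The primitive that makes `powSecondDiff a` integrate to zero against `s ^ (-1 - 2 * a)`. -/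
lemma hasDerivAt_one_sub_rpow_sq_mul_rpow {a s : ℝ} (ha : 0 < a) (hs : s ∈ Ioo (0 : ℝ) 1) :
    HasDerivAt (fun s : ℝ => (1 - (1 - s) ^ a) ^ 2 * s ^ (-2 * a) / (2 * a))
      ((((1 - s) ^ (a - 1) - (1 - s) ^ (2 * a - 1)) + ((1 - s) ^ a - 1)) * s ^ (-1 - 2 * a)) s := by
  obtain ⟨hs0, hs1⟩ := hs
  have hu : 0 < 1 - s := by linarith
  have h1 : HasDerivAt (fun s : ℝ => (1 - s) ^ a) (-1 * a * (1 - s) ^ (a - 1)) s :=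
    ((hasDerivAt_id s).const_sub 1).rpow_const (Or.inl hu.ne')
  have h2 : HasDerivAt (fun s : ℝ => s ^ (-2 * a)) (-2 * a * s ^ (-2 * a - 1)) s :=
    Real.hasDerivAt_rpow_const (Or.inl hs0.ne')
  refine ((((h1.const_sub 1).pow 2).mul h2).div_const (2 * a)).congr_deriv ?_
  have e1 : s ^ (-2 * a) = s ^ (-1 - 2 * a) * s := by
    rw [← Real.rpow_add_one hs0.ne']; ring_nf
  have e2 : (1 - s) ^ a = (1 - s) ^ (a - 1) * (1 - s) := by
    rw [← Real.rpow_add_one hu.ne']; ring_nf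
  have e3 : (1 - s) ^ (2 * a - 1) = (1 - s) ^ (a - 1) * (1 - s) ^ (a - 1) * (1 - s) := by
    rw [← Real.rpow_add hu, ← Real.rpow_add_one hu.ne']; ring_nf
  rw [e1, e3, e2, show -2 * a - 1 = -1 - 2 * a by ring]
  simp only [Pi.pow_apply]
  push_cast
  field_simp
  rw [e2]
  ring

lemma intervalIntegrable_one_sub_rpow_mul_rpow {δ r : ℝ} (c : ℝ) (hδ : 0 < δ) (hδ1 : δ < 1)
    (hr : -1 < r) :
    IntervalIntegrable (fun s : ℝ => (1 - s) ^ r * s ^ c) volume δ 1 := by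
  have h := (intervalIntegral.intervalIntegrable_rpow' (a := 1 - δ) (b := 0) hr).comp_sub_left 1
  simp only [sub_sub_cancel, sub_zero] at h
  refine h.mul_continuousOn ?_
  intro s hs
  rw [uIcc_of_le hδ1.le] at hs
  exact (Real.continuousAt_rpow_const _ _ (Or.inl (hδ.trans_le hs.1).ne')).continuousWithinAt

lemma image_div_one_sub_Ioo {δ : ℝ} (hδ1 : δ < 1) :
    (fun s : ℝ => s / (1 - s)) '' Ioo δ 1 = Ioi (δ / (1 - δ)) := by
  ext y
  simp only [mem_image, mem_Ioo, mem_Ioi]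
  constructor
  · rintro ⟨s, ⟨h1, h2⟩, rfl⟩
    rw [div_lt_div_iff₀ (by linarith) (by linarith)]
    nlinarith
  · intro hy
    rw [div_lt_iff₀ (by linarith)] at hy
    have hy1 : 0 < 1 + y := by nlinarith
    refine ⟨y / (1 + y), ⟨?_, ?_⟩, ?_⟩
    · rw [lt_div_iff₀ hy1]; nlinarith
    · rw [div_lt_one hy1]; linarith
    · field_simp; ring

lemma setIntegral_one_add_rpow_sub_one {a δ : ℝ} (hδ : 0 < δ) (hδ1 : δ < 1) :
    ∫ s in Ioi (δ / (1 - δ)), ((1 + s) ^ a - 1) * s ^ (-1 - 2 * a) =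
      ∫ s in Ioo δ 1, ((1 - s) ^ (a - 1) - (1 - s) ^ (2 * a - 1)) * s ^ (-1 - 2 * a) := by
  rw [← image_div_one_sub_Ioo hδ1,
    integral_image_eq_integral_abs_deriv_smul (f' := fun s => 1 / (1 - s) ^ 2) measurableSet_Ioo]
  · refine setIntegral_congr_fun measurableSet_Ioo fun s hs => ?_
    have hs0 : 0 < s := hδ.trans hs.1
    have hu : 0 < 1 - s := by linarith [hs.2]
    have e0 : 1 + s / (1 - s) = (1 - s)⁻¹ := by field_simp; ring
    have e1 : (1 - s) ^ (a - 1) = (1 - s) ^ (2 * a - 1) * (1 - s) ^ (-a) := by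
      rw [← Real.rpow_add hu]; ring_nf
    have e2 : (1 - s) ^ (2 * a - 1) = (1 - s) ^ (1 + 2 * a) / (1 - s) ^ 2 := by
      rw [← Real.rpow_two, ← Real.rpow_sub hu]; ring_nf
    simp only [smul_eq_mul]
    rw [e0, e1, e2, Real.div_rpow hs0.le hu.le, Real.inv_rpow hu.le, ← Real.rpow_neg hu.le,
      abs_of_pos (by positivity), show -1 - 2 * a = -(1 + 2 * a) by ring,
      Real.rpow_neg hu.le (1 + 2 * a)]
    field_simp
  · intro s hs
    have hu : 1 - s ≠ 0 := by linarith [hs.2]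
    refine HasDerivAt.hasDerivWithinAt ?_
    refine ((hasDerivAt_id s).div ((hasDerivAt_id s).const_sub 1) hu).congr_deriv ?_
    simp
  · intro s hs t ht h
    have hu : 1 - s ≠ 0 := by linarith [hs.2]
    have hv : 1 - t ≠ 0 := by linarith [ht.2]
    rw [div_eq_div_iff hu hv] at h
    linarith

lemma integrableOn_one_add_rpow_sub_one {a δ : ℝ} (ha : 0 < a) (ha1 : a < 1) (hδ : 0 < δ) :
    IntegrableOn (fun s : ℝ => ((1 + s) ^ a - 1) * s ^ (-1 - 2 * a)) (Ioi δ) := by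
  refine (integrableOn_Ioi_rpow_of_lt (a := -1 - a) (by linarith) hδ).mono'
    (by fun_prop : Measurable _).aestronglyMeasurable ?_
  filter_upwards [ae_restrict_mem measurableSet_Ioi] with s hs
  have hs0 : 0 < s := hδ.trans hs
  have h1 : 1 ≤ (1 + s) ^ a := Real.one_le_rpow (by linarith) ha.le
  have h2 : (1 + s) ^ a ≤ 1 + s ^ a := by
    simpa using Real.rpow_add_le_add_rpow zero_le_one hs0.le ha.le ha1.le
  rw [Real.norm_of_nonneg (mul_nonneg (by linarith) (by positivity))]
  calc _ ≤ s ^ a * s ^ (-1 - 2 * a) := by gcongr; linarith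
    _ = _ := by rw [← Real.rpow_add hs0]; ring_nf

lemma integrableOn_max_one_sub_rpow_sub_one {a δ : ℝ} (ha : 0 < a) (hδ : 0 < δ) :
    IntegrableOn (fun s : ℝ => ((max (1 - s) 0) ^ a - 1) * s ^ (-1 - 2 * a)) (Ioi δ) := by
  refine (integrableOn_Ioi_rpow_of_lt (a := -1 - 2 * a) (by linarith) hδ).mono'
    (by fun_prop : Measurable _).aestronglyMeasurable ?_
  filter_upwards [ae_restrict_mem measurableSet_Ioi] with s hs
  have hs0 : 0 < s := hδ.trans hs
  have h1 : 0 ≤ (max (1 - s) 0) ^ a := by positivity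
  have h2 : (max (1 - s) 0) ^ a ≤ 1 :=
    Real.rpow_le_one (le_max_right _ _) (max_le (by linarith) zero_le_one) ha.le
  rw [norm_mul, Real.norm_of_nonneg (by positivity : 0 ≤ s ^ (-1 - 2 * a))]
  refine mul_le_of_le_one_left (by positivity) ?_
  rw [Real.norm_eq_abs, abs_le]
  constructor <;> linarith

lemma setIntegral_max_one_sub_rpow_sub_one {a δ : ℝ} (ha : 0 < a) (hδ : 0 < δ) (hδ1 : δ < 1) :
    ∫ s in Ioi δ, ((max (1 - s) 0) ^ a - 1) * s ^ (-1 - 2 * a) =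
      (∫ s in δ..1, ((1 - s) ^ a - 1) * s ^ (-1 - 2 * a)) - 1 / (2 * a) := by
  have hI := integrableOn_max_one_sub_rpow_sub_one ha hδ
  rw [← Ioc_union_Ioi_eq_Ioi hδ1.le, setIntegral_union (Ioc_disjoint_Ioi le_rfl) measurableSet_Ioi
    (hI.mono_set Ioc_subset_Ioi_self) (hI.mono_set (Ioi_subset_Ioi hδ1.le)), sub_eq_add_neg _ (1 / (2 * a)),
    intervalIntegral.integral_of_le hδ1.le]
  congr 1
  · refine setIntegral_congr_fun measurableSet_Ioc fun s hs => ?_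
    rw [max_eq_left (by linarith [hs.2])]
  · have : ∀ s ∈ Ioi (1 : ℝ), ((max (1 - s) 0) ^ a - 1) * s ^ (-1 - 2 * a) =
        -(s ^ (-1 - 2 * a)) := fun s hs => by
      rw [max_eq_right (by linarith [mem_Ioi.1 hs]), Real.zero_rpow ha.ne']; ring
    rw [setIntegral_congr_fun measurableSet_Ioi this, integral_neg,
      integral_Ioi_rpow_of_lt (by linarith) zero_lt_one, Real.one_rpow,
      show -1 - 2 * a + 1 = -(2 * a) by ring, neg_div_neg_eq]

lemma integral_one_sub_rpow_eq {a δ : ℝ} (ha : 0 < a) (hδ : 0 < δ) (hδ1 : δ < 1) :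
    (∫ s in Ioo δ 1, ((1 - s) ^ (a - 1) - (1 - s) ^ (2 * a - 1)) * s ^ (-1 - 2 * a)) +
      (∫ s in δ..1, ((1 - s) ^ a - 1) * s ^ (-1 - 2 * a)) =
      1 / (2 * a) - (1 - (1 - δ) ^ a) ^ 2 * δ ^ (-2 * a) / (2 * a) := by
  have i1 := intervalIntegrable_one_sub_rpow_mul_rpow (r := a - 1) (-1 - 2 * a) hδ hδ1 (by linarith)
  have i2 := intervalIntegrable_one_sub_rpow_mul_rpow (r := 2 * a - 1) (-1 - 2 * a) hδ hδ1
    (by linarith)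
  have i3 := intervalIntegrable_one_sub_rpow_mul_rpow (r := a) (-1 - 2 * a) hδ hδ1 (by linarith)
  have i4 := intervalIntegrable_one_sub_rpow_mul_rpow (r := 0) (-1 - 2 * a) hδ hδ1 (by norm_num)
  simp only [Real.rpow_zero] at i4
  have i12 := i1.sub i2
  have i34 := i3.sub i4
  simp only [← sub_mul] at i12 i34
  rw [← integral_Ioc_eq_integral_Ioo, ← intervalIntegral.integral_of_le hδ1.le,
    ← intervalIntegral.integral_add i12 i34]
  simp only [← add_mul]
  rw [intervalIntegral.integral_eq_sub_of_hasDerivAt_of_le hδ1.le _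
    (fun s hs => hasDerivAt_one_sub_rpow_sq_mul_rpow ha ⟨hδ.trans hs.1, hs.2⟩)]
  · simp [Real.zero_rpow ha.ne']
  · simpa only [← add_mul] using i12.add i34
  · refine ((((continuousOn_const.sub ((continuousOn_const.sub continuousOn_id).rpow_const
      fun _ _ => Or.inr ha.le)).pow 2).mul (continuousOn_id.rpow_const fun s hs =>
      Or.inl (hδ.trans_le hs.1).ne')).div_const _)

lemma setIntegral_Ioi_powSecondDiff_ge {a δ : ℝ} (ha : 0 < a) (ha1 : a < 1) (hδ : 0 < δ)
    (hδ1 : δ < 1) :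
    -(δ ^ (2 - 2 * a) / (2 * a)) ≤ ∫ s in Ioi δ, powSecondDiff a s * s ^ (-1 - 2 * a) := by
  have e : ∀ s ∈ Ioi δ, powSecondDiff a s * s ^ (-1 - 2 * a) =
      ((1 + s) ^ a - 1) * s ^ (-1 - 2 * a) + ((max (1 - s) 0) ^ a - 1) * s ^ (-1 - 2 * a) := by
    intro s hs
    rw [powSecondDiff, max_eq_left (by linarith [mem_Ioi.1 hs])]
    ring
  have hI := integrableOn_one_add_rpow_sub_one ha ha1 hδ
  have hle : δ ≤ δ / (1 - δ) := by rw [le_div_iff₀ (by linarith)]; nlinarith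
  have hmono : ∫ s in Ioi (δ / (1 - δ)), ((1 + s) ^ a - 1) * s ^ (-1 - 2 * a) ≤
      ∫ s in Ioi δ, ((1 + s) ^ a - 1) * s ^ (-1 - 2 * a) := by
    refine setIntegral_mono_set hI ?_ (Ioi_subset_Ioi hle).eventuallyLE
    filter_upwards [ae_restrict_mem measurableSet_Ioi] with s hs
    have hs0 : 0 < s := hδ.trans hs
    have h1 : 1 ≤ (1 + s) ^ a := Real.one_le_rpow (by linarith) ha.le
    exact mul_nonneg (by linarith) (by positivity)
  rw [setIntegral_congr_fun measurableSet_Ioi e,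
    integral_add hI (integrableOn_max_one_sub_rpow_sub_one ha hδ),
    setIntegral_max_one_sub_rpow_sub_one ha hδ hδ1]
  rw [setIntegral_one_add_rpow_sub_one hδ hδ1] at hmono
  have hsum := integral_one_sub_rpow_eq ha hδ hδ1
  have hb0 : 0 ≤ 1 - (1 - δ) ^ a := by
    have := Real.rpow_le_one (by linarith : 0 ≤ 1 - δ) (by linarith) ha.le
    linarith
  have hb1 : 1 - (1 - δ) ^ a ≤ δ := by
    have := Real.self_le_rpow_of_le_one (by linarith : 0 ≤ 1 - δ) (by linarith) ha1.le
    linarith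
  have hb : (1 - (1 - δ) ^ a) ^ 2 * δ ^ (-2 * a) / (2 * a) ≤ δ ^ (2 - 2 * a) / (2 * a) := by
    have : δ ^ (2 - 2 * a) = δ ^ 2 * δ ^ (-2 * a) := by
      rw [← Real.rpow_two, ← Real.rpow_add hδ]; ring_nf
    rw [this]
    gcongr
  linarith

/-- Truncations of an integrable function away from small values of `r` converge. -/
lemma tendsto_setIntegral_lt {X : Type*} [MeasurableSpace X] {μ : Measure X} {r f : X → ℝ}
    (hr : Measurable r) (hf : Integrable f μ) :
    Tendsto (fun ε => ∫ x in {x | ε < r x}, f x ∂μ) (nhdsWithin 0 (Ioi 0))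
      (nhds (∫ x in {x | 0 < r x}, f x ∂μ)) := by
  have hm : ∀ ε, MeasurableSet {x | ε < r x} := fun ε => measurableSet_lt measurable_const hr
  simp_rw [← integral_indicator (hm _)]
  refine tendsto_integral_filter_of_dominated_convergence (fun x => ‖f x‖) ?_ ?_ hf.norm ?_
  · exact Eventually.of_forall fun ε => hf.aestronglyMeasurable.indicator (hm ε)
  · exact Eventually.of_forall fun ε => Eventually.of_forall fun x => norm_indicator_le_norm_self _ _
  · refine Eventually.of_forall fun x => tendsto_const_nhds.congr' ?_
    by_cases hx : 0 < r x
    · filter_upwards [nhdsWithin_le_nhds (Iio_mem_nhds hx)] with ε hε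
      rw [indicator_of_mem (s := {x | ε < r x}) (by exact hε), indicator_of_mem (by exact hx)]
    · filter_upwards [self_mem_nhdsWithin] with ε hε
      rw [indicator_of_notMem (s := {x | ε < r x})
        (by simp only [mem_ofPred_eq, not_lt]; exact (not_lt.1 hx).trans (le_of_lt hε)),
        indicator_of_notMem (by exact hx)]

lemma integral_powSecondDiff_nonneg {a : ℝ} (ha : 0 < a) (ha1 : a < 1) :
    0 ≤ ∫ s in Ioi (0 : ℝ), powSecondDiff a s * s ^ (-1 - 2 * a) := by
  have hI := integrableOn_powSecondDiff_mul_rpow (α := 2 * a) (p := a) (by linarith) ha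
    (by linarith)
  have h := tendsto_setIntegral_lt (r := fun s : ℝ => s) measurable_id hI
  have h0 : Tendsto (fun δ : ℝ => -(δ ^ (2 - 2 * a) / (2 * a))) (nhdsWithin 0 (Ioi 0)) (nhds 0) := by
    have h1 : ContinuousAt (fun δ : ℝ => -(δ ^ (2 - 2 * a) / (2 * a))) 0 :=
      ((Real.continuousAt_rpow_const _ _ (Or.inr (by linarith))).div_const _).neg
    have h2 := h1.tendsto.mono_left (nhdsWithin_le_nhds (s := Ioi (0 : ℝ)))
    rwa [Real.zero_rpow (by linarith), zero_div, neg_zero] at h2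
  have h3 := le_of_tendsto_of_tendsto h0 h (by
    filter_upwards [self_mem_nhdsWithin, nhdsWithin_le_nhds (Iio_mem_nhds (zero_lt_one' ℝ))]
      with δ hδ hδ1
    have hδ0 : (0 : ℝ) < δ := hδ
    change _ ≤ ∫ s in Ioi δ, _ ∂(volume.restrict (Ioi 0))
    rw [Measure.restrict_restrict measurableSet_Ioi, inter_eq_left.2 (Ioi_subset_Ioi hδ0.le)]
    exact setIntegral_Ioi_powSecondDiff_ge ha ha1 hδ0 hδ1)
  change 0 ≤ ∫ s in Ioi 0, _ ∂(volume.restrict (Ioi 0)) at h3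
  rwa [Measure.restrict_restrict measurableSet_Ioi, inter_self] at h3

lemma mul_sub_one_le_rpow_sub_one {q u : ℝ} (hq : 1 < q) (hu : 0 ≤ u) :
    q * (u - 1) ≤ u ^ q - 1 := by
  have h := one_add_mul_self_le_rpow_one_add (s := u - 1) (by linarith) hq.le
  rw [add_sub_cancel] at h
  linarith

lemma mul_powSecondDiff_lt {a p s : ℝ} (ha : 0 < a) (hap : a < p) (hs : 0 < s) :
    p / a * powSecondDiff a s < powSecondDiff p s := by
  have hq : 1 < p / a := by rwa [one_lt_div ha]
  have e : ∀ t : ℝ, (max t 0) ^ p = ((max t 0) ^ a) ^ (p / a) := fun t => by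
    rw [← Real.rpow_mul (le_max_right _ _), mul_div_cancel₀ _ ha.ne']
  rw [powSecondDiff, powSecondDiff, e, e (1 - s)]
  have h1 := one_add_mul_self_lt_rpow_one_add (s := (max (1 + s) 0) ^ a - 1)
    (by linarith [Real.rpow_nonneg (le_max_right (1 + s) 0) a])
    (by
      rw [max_eq_left (by linarith)]
      linarith [Real.one_lt_rpow (by linarith : 1 < 1 + s) ha]) hq
  rw [add_sub_cancel] at h1
  have h2 := mul_sub_one_le_rpow_sub_one hq (Real.rpow_nonneg (le_max_right (1 - s) 0) a)
  linarith

lemma integral_powSecondDiff_pos {α p : ℝ} (hα0 : 0 < α) (hα2 : α < 2) (hp : α / 2 < p)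
    (hpα : p < α) : 0 < ∫ s in Ioi (0 : ℝ), powSecondDiff p s * s ^ (-1 - α) := by
  have i1 := integrableOn_powSecondDiff_mul_rpow hα2 (by linarith) hpα
  have i2 := (integrableOn_powSecondDiff_mul_rpow (p := α / 2) hα2 (by linarith)
    (by linarith)).const_mul (p / (α / 2))
  have h0 := integral_powSecondDiff_nonneg (a := α / 2) (by linarith) (by linarith)
  rw [mul_div_cancel₀ α two_ne_zero] at h0
  have hpos : ∀ s ∈ Ioi (0 : ℝ), 0 < powSecondDiff p s * s ^ (-1 - α) -
      p / (α / 2) * (powSecondDiff (α / 2) s * s ^ (-1 - α)) := by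
    intro s hs
    have hk : 0 < s ^ (-1 - α) := Real.rpow_pos_of_pos hs _
    rw [← mul_assoc, ← sub_mul]
    exact mul_pos (sub_pos.2 (mul_powSecondDiff_lt (by linarith) hp hs)) hk
  have h1 : 0 < ∫ s in Ioi (0 : ℝ), (powSecondDiff p s * s ^ (-1 - α) -
      p / (α / 2) * (powSecondDiff (α / 2) s * s ^ (-1 - α))) := by
    refine (setIntegral_pos_iff_support_of_nonneg_ae ?_ (i1.sub i2)).2 ?_
    rotate_left
    · change 0 < volume (Function.support (fun s => powSecondDiff p s * s ^ (-1 - α) -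
        p / (α / 2) * (powSecondDiff (α / 2) s * s ^ (-1 - α))) ∩ Ioi 0)
      exact (by simp : 0 < volume (Ioi (0 : ℝ))).trans_le
        (measure_mono fun s hs => ⟨(hpos s hs).ne', hs⟩)
    · filter_upwards [ae_restrict_mem measurableSet_Ioi] with s hs using (hpos s hs).le
  rw [integral_sub i1 i2, integral_const_mul] at h1
  have : 0 ≤ p / (α / 2) := by
    have : 0 < p := by linarith
    positivity
  nlinarith [mul_nonneg this h0]

/-- Integration in polar coordinates. -/
lemma integral_eq_integral_toSphere_Ioi {E : Type*} [NormedAddCommGroup E] [NormedSpace ℝ E]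
    [MeasurableSpace E] [BorelSpace E] [FiniteDimensional ℝ E] [Nontrivial E] (μ : Measure E)
    [μ.IsAddHaarMeasure] {f : E → ℝ} (hf : Integrable f μ) :
    ∫ x, f x ∂μ = ∫ θ : Metric.sphere (0 : E) 1,
      (∫ r in Ioi (0 : ℝ), r ^ (Module.finrank ℝ E - 1) * f (r • (θ : E))) ∂μ.toSphere := by
  have hmp := μ.measurePreserving_homeomorphUnitSphereProd
  have hemb := (homeomorphUnitSphereProd E).measurableEmbedding
  set g : Metric.sphere (0 : E) 1 × Ioi (0 : ℝ) → ℝ :=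
    fun q => f ((homeomorphUnitSphereProd E).symm q) with hg
  have hgc : g ∘ homeomorphUnitSphereProd E = fun x : ({0}ᶜ : Set E) => f x := by
    ext x
    simp only [hg, Function.comp_apply, Homeomorph.symm_apply_apply]
  have hint : Integrable g
      (μ.toSphere.prod (Measure.volumeIoiPow (Module.finrank ℝ E - 1))) := by
    rw [← hmp.integrable_comp_emb hemb, hgc]
    exact (integrableOn_iff_comap_subtypeVal (measurableSet_singleton _).compl).1 hf.integrableOn
  have h1 : ∫ x, f x ∂μ =
      ∫ q, g q ∂(μ.toSphere.prod (Measure.volumeIoiPow (Module.finrank ℝ E - 1))) := by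
    rw [← hmp.integral_comp hemb]
    change _ = ∫ x, (g ∘ homeomorphUnitSphereProd E) x ∂_
    rw [hgc, integral_subtype_comap (measurableSet_singleton _).compl f, restrict_compl_singleton]
  rw [h1, integral_prod _ hint]
  congr 1
  ext θ
  simp only [Measure.volumeIoiPow, ENNReal.ofReal]
  rw [integral_withDensity_eq_integral_smul (by fun_prop)]
  simp only [hg, homeomorphUnitSphereProd_symm_apply_coe]
  rw [integral_subtype_comap measurableSet_Ioi
    fun r : ℝ => Real.toNNReal (r ^ (Module.finrank ℝ E - 1)) • f (r • (θ : E))]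
  refine setIntegral_congr_fun measurableSet_Ioi fun r hr => ?_
  simp only [NNReal.smul_def, smul_eq_mul]
  rw [Real.coe_toNNReal _ (pow_nonneg (le_of_lt hr) _)]

lemma nontrivial_euclideanSpace_of_fin {d : ℕ} (i : Fin d) :
    Nontrivial (EuclideanSpace ℝ (Fin d)) :=
  Module.nontrivial_of_finrank_pos (R := ℝ) (by
    rw [finrank_euclideanSpace_fin]; exact i.pos)

lemma pow_pred_mul_div_rpow {d : ℕ} (hd : 0 < d) (α c : ℝ) {r : ℝ} (hr : 0 < r) :
    r ^ (d - 1) * (c / r ^ ((d : ℝ) + α)) = c * r ^ (-1 - α) := by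
  have h : r ^ (-1 - α) = r ^ (d - 1) / r ^ ((d : ℝ) + α) := by
    rw [← Real.rpow_natCast, ← Real.rpow_sub hr, Nat.cast_sub hd]
    congr 1
    push_cast
    ring
  rw [h]
  ring

lemma abs_apply_le_norm {d : ℕ} (i : Fin d) (z : EuclideanSpace ℝ (Fin d)) : |z i| ≤ ‖z‖ := by
  simpa using PiLp.norm_apply_le z i

lemma integrable_powSecondDiff_div_norm {d : ℕ} (i : Fin d) {α p : ℝ} (hα2 : α < 2) (hp : 0 < p)
    (hpα : p < α) :
    Integrable fun z : EuclideanSpace ℝ (Fin d) =>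
      powSecondDiff p (z i) / ‖z‖ ^ ((d : ℝ) + α) := by
  have := nontrivial_euclideanSpace_of_fin i
  have hb : Integrable fun z : EuclideanSpace ℝ (Fin d) =>
      min (‖z‖ ^ 2) (‖z‖ ^ p) / ‖z‖ ^ ((d : ℝ) + α) := by
    refine (integrable_fun_norm_addHaar volume
      (f := fun r : ℝ => min (r ^ 2) (r ^ p) / r ^ ((d : ℝ) + α))).2 ?_
    refine (integrableOn_min_sq_rpow_mul_rpow hα2 hpα).congr_fun (fun r hr => ?_) measurableSet_Ioi
    rw [finrank_euclideanSpace_fin, smul_eq_mul, pow_pred_mul_div_rpow i.pos α _ hr]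
  have hm : Measurable fun z : EuclideanSpace ℝ (Fin d) =>
      powSecondDiff p (z i) / ‖z‖ ^ ((d : ℝ) + α) :=
    ((continuous_powSecondDiff hp).measurable.comp (by fun_prop)).div (by fun_prop)
  refine (hb.const_mul 4).mono' hm.aestronglyMeasurable (Eventually.of_forall fun z => ?_)
  have h1 := abs_powSecondDiff_le hp (hpα.trans hα2) (z i)
  have h2 := abs_apply_le_norm i z
  rw [norm_div, Real.norm_eq_abs, Real.norm_of_nonneg (by positivity), mul_div_assoc']
  gcongr
  exact h1.trans (by gcongr)

lemma integral_powSecondDiff_div_norm {d : ℕ} (i : Fin d) {α p : ℝ} (hα2 : α < 2) (hp : 0 < p)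
    (hpα : p < α) :
    ∫ z : EuclideanSpace ℝ (Fin d), powSecondDiff p (z i) / ‖z‖ ^ ((d : ℝ) + α) =
      (∫ θ : Metric.sphere (0 : EuclideanSpace ℝ (Fin d)) 1,
        |(θ : EuclideanSpace ℝ (Fin d)) i| ^ α ∂(volume : Measure _).toSphere) *
      ∫ s in Ioi (0 : ℝ), powSecondDiff p s * s ^ (-1 - α) := by
  have := nontrivial_euclideanSpace_of_fin i
  rw [integral_eq_integral_toSphere_Ioi _ (integrable_powSecondDiff_div_norm i hα2 hp hpα),
    ← integral_mul_const]
  congr 1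
  ext θ
  have hθ : ‖(θ : EuclideanSpace ℝ (Fin d))‖ = 1 := by simp
  set c : ℝ := (θ : EuclideanSpace ℝ (Fin d)) i with hc
  have h1 : ∫ r in Ioi (0 : ℝ), r ^ (Module.finrank ℝ (EuclideanSpace ℝ (Fin d)) - 1) *
      (powSecondDiff p ((r • (θ : EuclideanSpace ℝ (Fin d))) i) /
        ‖r • (θ : EuclideanSpace ℝ (Fin d))‖ ^ ((d : ℝ) + α)) =
      ∫ r in Ioi (0 : ℝ), powSecondDiff p (|c| * r) * r ^ (-1 - α) := by
    refine setIntegral_congr_fun measurableSet_Ioi fun r hr => ?_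
    have hr0 : 0 < r := hr
    simp only [finrank_euclideanSpace_fin, norm_smul, hθ, mul_one, Real.norm_eq_abs,
      abs_of_pos hr0, PiLp.smul_apply, smul_eq_mul]
    rw [pow_pred_mul_div_rpow i.pos α _ hr0, ← powSecondDiff_abs, abs_mul, abs_of_pos hr0,
      mul_comm r, hc]
  rw [h1]
  rcases eq_or_ne c 0 with h0 | h0
  · have hα : α ≠ 0 := (hp.trans hpα).ne'
    simp [h0, Real.zero_rpow hα, powSecondDiff_zero]
  · have hc0 : 0 < |c| := abs_pos.2 h0
    have h2 := integral_comp_mul_left_Ioi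
      (fun s : ℝ => powSecondDiff p s * s ^ (-1 - α)) 0 hc0
    rw [mul_zero, smul_eq_mul] at h2
    have h3 : ∫ s in Ioi (0 : ℝ), powSecondDiff p s * s ^ (-1 - α) =
        |c| * ∫ r in Ioi (0 : ℝ), powSecondDiff p (|c| * r) * (|c| * r) ^ (-1 - α) := by
      rw [h2, mul_inv_cancel_left₀ hc0.ne']
    rw [h3, ← mul_assoc, ← integral_const_mul]
    refine setIntegral_congr_fun measurableSet_Ioi fun r hr => ?_
    have h4 : |c| ^ α * |c| * |c| ^ (-1 - α) = 1 := by
      rw [← Real.rpow_add_one hc0.ne', ← Real.rpow_add hc0, show α + 1 + (-1 - α) = 0 by ring,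
        Real.rpow_zero]
    rw [Real.mul_rpow hc0.le (le_of_lt hr)]
    linear_combination (-(powSecondDiff p (|c| * r) * r ^ (-1 - α))) * h4

lemma integral_toSphere_abs_rpow_pos {d : ℕ} (i : Fin d) {α : ℝ} (hα : 0 < α) :
    0 < ∫ θ : Metric.sphere (0 : EuclideanSpace ℝ (Fin d)) 1,
      |(θ : EuclideanSpace ℝ (Fin d)) i| ^ α ∂(volume : Measure _).toSphere := by
  have hcont : Continuous fun θ : Metric.sphere (0 : EuclideanSpace ℝ (Fin d)) 1 =>
      |(θ : EuclideanSpace ℝ (Fin d)) i| ^ α :=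
    (by fun_prop : Continuous fun θ : Metric.sphere (0 : EuclideanSpace ℝ (Fin d)) 1 =>
      |(θ : EuclideanSpace ℝ (Fin d)) i|).rpow_const fun _ => Or.inr hα.le
  refine hcont.integral_pos_of_hasCompactSupport_nonneg_nonzero
    (HasCompactSupport.of_compactSpace _) (fun θ => by positivity)
    (x := ⟨EuclideanSpace.single i 1, by simp⟩) ?_
  simp

lemma integral_powSecondDiff_div_norm_pos {d : ℕ} (i : Fin d) {α p : ℝ} (hα0 : 0 < α)
    (hα2 : α < 2) (hp : α / 2 < p) (hpα : p < α) :
    0 < ∫ z : EuclideanSpace ℝ (Fin d), powSecondDiff p (z i) / ‖z‖ ^ ((d : ℝ) + α) := by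
  rw [integral_powSecondDiff_div_norm i hα2 (by linarith) hpα]
  exact mul_pos (integral_toSphere_abs_rpow_pos i hα0) (integral_powSecondDiff_pos hα0 hα2 hp hpα)

lemma fracConst_pos (d : ℕ) {α : ℝ} (hα0 : 0 < α) (hα2 : α < 2) : 0 < fracConst d α := by
  have h1 : 0 < Real.Gamma (((d : ℝ) + α) / 2) := Real.Gamma_pos_of_pos (by positivity)
  have h2 : 0 < Real.Gamma (1 - α / 2) := Real.Gamma_pos_of_pos (by linarith)
  have := Real.pi_pos
  unfold fracConst
  positivity

lemma pvInt_eq_setIntegral_norm (d : ℕ) (α : ℝ) (u : EuclideanSpace ℝ (Fin d) → ℝ)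
    (x : EuclideanSpace ℝ (Fin d)) (ε : ℝ) :
    pvInt d α u x ε = ∫ z in {z | ε < ‖z‖}, (u (x + z) - u x) / ‖z‖ ^ ((d : ℝ) + α) := by
  have h := (measurePreserving_add_left (volume : Measure (EuclideanSpace ℝ (Fin d)))
    x).setIntegral_preimage_emb (measurableEmbedding_addLeft x)
    (fun y => (u y - u x) / dist x y ^ ((d : ℝ) + α)) {y | ε < dist y x}
  rw [pvInt, ← h]
  simp [preimage, dist_eq_norm]

lemma setIntegral_norm_eq_half_integral_symm {E : Type*} [NormedAddCommGroup E]
    [MeasurableSpace E] [BorelSpace E] {μ : Measure E} [μ.IsNegInvariant] {f : E → ℝ} {ε : ℝ}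
    (hf : IntegrableOn f {z | ε < ‖z‖} μ) :
    ∫ z in {z | ε < ‖z‖}, f z ∂μ = 1 / 2 * ∫ z in {z | ε < ‖z‖}, (f z + f (-z)) ∂μ := by
  have hpre : (Neg.neg : E → E) ⁻¹' {z | ε < ‖z‖} = {z | ε < ‖z‖} := by
    ext z; simp
  have hmp := Measure.measurePreserving_neg μ
  have hemb := (Homeomorph.neg E).measurableEmbedding
  have h1 := hmp.setIntegral_preimage_emb hemb f {z | ε < ‖z‖}
  have h2 := (hmp.integrableOn_comp_preimage hemb (f := f) (s := {z | ε < ‖z‖})).2 hf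
  rw [hpre] at h1 h2
  have h3 := integral_add hf h2
  simp only [Function.comp_apply] at h3
  rw [h3, h1]
  ring

lemma integrableOn_norm_rpow_of_lt {d : ℕ} (i : Fin d) {α p ε : ℝ} (hε : 0 < ε) (hpα : p < α) :
    IntegrableOn (fun z : EuclideanSpace ℝ (Fin d) => ‖z‖ ^ p / ‖z‖ ^ ((d : ℝ) + α))
      {z | ε < ‖z‖} := by
  have := nontrivial_euclideanSpace_of_fin i
  have hm : MeasurableSet {z : EuclideanSpace ℝ (Fin d) | ε < ‖z‖} :=
    measurableSet_lt measurable_const measurable_norm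
  rw [← integrable_indicator_iff hm]
  refine (integrable_fun_norm_addHaar volume
    (f := (Ioi ε).indicator fun r : ℝ => r ^ p / r ^ ((d : ℝ) + α))).2 ?_
  have h := ((integrableOn_Ioi_rpow_of_lt (a := p + (-1 - α)) (by linarith) hε).integrable_indicator
    measurableSet_Ioi).integrableOn (s := Ioi 0)
  refine h.congr_fun (fun r hr => ?_) measurableSet_Ioi
  by_cases hr' : r ∈ Ioi ε
  · rw [indicator_of_mem hr', indicator_of_mem hr', finrank_euclideanSpace_fin, smul_eq_mul,
      pow_pred_mul_div_rpow i.pos α _ hr, Real.rpow_add hr]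
  · rw [indicator_of_notMem hr', indicator_of_notMem hr', smul_zero]

lemma abs_max_add_rpow_sub_le {a p ε s r : ℝ} (ha : 0 < a) (hp : 0 < p) (hε : 0 < ε)
    (hεr : ε < r) (hsr : |s| ≤ r) :
    |(max (a + s) 0) ^ p - (max a 0) ^ p| ≤ (a / ε + 1) ^ p * r ^ p := by
  have hr : 0 < r := hε.trans hεr
  have har : a ≤ a / ε * r := by
    rw [div_mul_eq_mul_div, le_div_iff₀ hε]; gcongr
  have key : ∀ t : ℝ, t ≤ a + r → (max t 0) ^ p ≤ (a / ε + 1) ^ p * r ^ p := fun t ht => by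
    rw [← Real.mul_rpow (by positivity) hr.le]
    exact Real.rpow_le_rpow (le_max_right _ _) (max_le (by linarith) (by positivity)) hp.le
  have h1 := key (a + s) (by linarith [le_abs_self s])
  have h2 := key a (by linarith)
  have h3 : 0 ≤ (max (a + s) 0) ^ p := by positivity
  have h4 : 0 ≤ (max a 0) ^ p := by positivity
  rw [abs_le]
  constructor <;> linarith

lemma integrableOn_max_add_rpow_sub_div {d : ℕ} (i : Fin d) {α a p ε : ℝ} (ha : 0 < a) (hp : 0 < p)
    (hε : 0 < ε) (hpα : p < α) :
    IntegrableOn (fun z : EuclideanSpace ℝ (Fin d) =>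
      ((max (a + z i) 0) ^ p - (max a 0) ^ p) / ‖z‖ ^ ((d : ℝ) + α)) {z | ε < ‖z‖} := by
  have hm : Measurable fun z : EuclideanSpace ℝ (Fin d) =>
      ((max (a + z i) 0) ^ p - (max a 0) ^ p) / ‖z‖ ^ ((d : ℝ) + α) := by fun_prop
  refine ((integrableOn_norm_rpow_of_lt i hε hpα).const_mul ((a / ε + 1) ^ p)).mono'
    hm.aestronglyMeasurable ?_
  filter_upwards [ae_restrict_mem (measurableSet_lt measurable_const measurable_norm)] with z hz
  rw [norm_div, Real.norm_eq_abs, Real.norm_of_nonneg (by positivity), mul_div_assoc']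
  gcongr
  exact abs_max_add_rpow_sub_le ha hp hε hz (abs_apply_le_norm i z)

lemma max_add_rpow_symm_eq {a p : ℝ} (ha : 0 < a) (s : ℝ) :
    ((max (a + s) 0) ^ p - (max a 0) ^ p) + ((max (a - s) 0) ^ p - (max a 0) ^ p) =
      a ^ p * powSecondDiff p (a⁻¹ * s) := by
  have e : ∀ t : ℝ, (max (a * t) 0) ^ p = a ^ p * (max t 0) ^ p := fun t => by
    rw [← Real.mul_rpow ha.le (le_max_right _ _), mul_max_of_nonneg _ _ ha.le, mul_zero]
  have e1 : a + s = a * (1 + a⁻¹ * s) := by field_simp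
  have e2 : a - s = a * (1 - a⁻¹ * s) := by field_simp
  rw [powSecondDiff, e1, e2, e, e, max_eq_left ha.le]
  ring

lemma pvInt_max_rpow_eq {d : ℕ} (i : Fin d) {α p : ℝ} (hp : 0 < p) (hpα : p < α)
    {x : EuclideanSpace ℝ (Fin d)} (hx : 0 < x i) {ε : ℝ} (hε : 0 < ε) :
    pvInt d α (fun y => (max (y i) 0) ^ p) x ε =
      ∫ z : EuclideanSpace ℝ (Fin d) in {z | ε < ‖z‖}, 1 / 2 * (x i) ^ (p - ((d : ℝ) + α)) *
        (powSecondDiff p (((x i)⁻¹ • z) i) / ‖(x i)⁻¹ • z‖ ^ ((d : ℝ) + α)) := by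
  rw [pvInt_eq_setIntegral_norm]
  simp only [PiLp.add_apply]
  rw [setIntegral_norm_eq_half_integral_symm (integrableOn_max_add_rpow_sub_div i hx hp hε hpα),
    ← integral_const_mul]
  congr 1
  ext z
  have hk : ‖(x i)⁻¹ • z‖ ^ ((d : ℝ) + α) = ‖z‖ ^ ((d : ℝ) + α) / (x i) ^ ((d : ℝ) + α) := by
    rw [norm_smul, Real.norm_of_nonneg (by positivity), Real.mul_rpow (by positivity)
      (norm_nonneg _), Real.inv_rpow hx.le]
    ring
  have hc : (x i) ^ ((d : ℝ) + α) ≠ 0 := (Real.rpow_pos_of_pos hx _).ne'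
  rw [hk, norm_neg, ← add_div, PiLp.neg_apply, ← sub_eq_add_neg, max_add_rpow_symm_eq hx,
    PiLp.smul_apply, smul_eq_mul, Real.rpow_sub hx]
  field_simp

theorem tendsto_pvInt_max_rpow {d : ℕ} (i : Fin d) {α p : ℝ} (hα2 : α < 2) (hp : 0 < p)
    (hpα : p < α) {x : EuclideanSpace ℝ (Fin d)} (hx : 0 < x i) :
    Tendsto (pvInt d α (fun y => (max (y i) 0) ^ p) x) (nhdsWithin 0 (Ioi 0))
      (nhds (1 / 2 * (x i) ^ (p - α) *
        ∫ z : EuclideanSpace ℝ (Fin d), powSecondDiff p (z i) / ‖z‖ ^ ((d : ℝ) + α))) := by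
  have := nontrivial_euclideanSpace_of_fin i
  have hI := ((integrable_powSecondDiff_div_norm i hα2 hp hpα).comp_smul
    (inv_ne_zero hx.ne')).const_mul (1 / 2 * (x i) ^ (p - ((d : ℝ) + α)))
  have h := tendsto_setIntegral_lt measurable_norm hI
  have h0 : {z : EuclideanSpace ℝ (Fin d) | 0 < ‖z‖} = {0}ᶜ := by ext z; simp
  rw [h0, restrict_compl_singleton, integral_const_mul,
    Measure.integral_comp_smul volume (fun z : EuclideanSpace ℝ (Fin d) =>
      powSecondDiff p (z i) / ‖z‖ ^ ((d : ℝ) + α)), finrank_euclideanSpace_fin, inv_pow, inv_inv,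
    abs_of_pos (by positivity), smul_eq_mul, ← mul_assoc] at h
  have e : 1 / 2 * (x i) ^ (p - ((d : ℝ) + α)) * (x i) ^ d = 1 / 2 * (x i) ^ (p - α) := by
    rw [mul_assoc, ← Real.rpow_natCast, ← Real.rpow_add hx]
    congr 2
    ring
  rw [e] at h
  refine h.congr' ?_
  filter_upwards [self_mem_nhdsWithin] with ε hε
  exact (pvInt_max_rpow_eq i hp hpα hx hε).symm

/-- For every `p ∈ (α/2, α)` there is a constant `C = C(d, α, p) > 0` such that for every
`x` with `x₁ > 0`, the principal value limit defining `Δ^{α/2} w_p(x)` exists and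
`Δ^{α/2} w_p(x) = C x₁^{p-α}`, where `w_p(x) = (x₁⁺)^p`. -/
theorem statement1 (d : ℕ) (hd : 1 ≤ d) (α : ℝ) (hα : α ∈ Set.Ioo (0 : ℝ) 2)
    (p : ℝ) (hp : p ∈ Set.Ioo (α / 2) α) :
    ∃ C : ℝ, 0 < C ∧
      ∀ x : EuclideanSpace ℝ (Fin d), 0 < x ⟨0, hd⟩ →
        ∃ L : ℝ,
          Filter.Tendsto (pvInt d α (fun y => (max (y ⟨0, hd⟩) 0) ^ p) x)
            (nhdsWithin 0 (Set.Ioi 0)) (nhds L) ∧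
          fracConst d α * L = C * (x ⟨0, hd⟩) ^ (p - α) := by
  obtain ⟨hα0, hα2⟩ := hα
  obtain ⟨hp1, hp2⟩ := hp
  refine ⟨fracConst d α * (1 / 2 * ∫ z : EuclideanSpace ℝ (Fin d),
    powSecondDiff p (z ⟨0, hd⟩) / ‖z‖ ^ ((d : ℝ) + α)), ?_, fun x hx =>
    ⟨_, tendsto_pvInt_max_rpow ⟨0, hd⟩ hα2 (by linarith) hp2 hx, by ring⟩⟩
  have h1 := fracConst_pos d hα0 hα2
  have h2 := integral_powSecondDiff_div_norm_pos ⟨0, hd⟩ hα0 hα2 hp1 hp2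
  positivity
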